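/- For every finite metric space G = (V,d) with |V| ≥ 2 and every vertex v₀ ∈ V, there exists a spanning tree T of the complete graph on V with edge weights d whose total weight equals MST(G), such that, rooting T at v₀ and writing P_T(v) for the parent of v in T, for every subset V' ⊆ V with v₀ ∈ V' one has Σ_{v ∈ V' \ {v₀}} d(v, P_T(v)) ≤ Steiner_G(V'). -/

import Mathlib

/-- The total `dist`-weight of the edges of a graph on a metric space. -/
noncomputable def graphWeight {V : Type} [MetricSpace V] (G : SimpleGraph V) : ℝ :=
  ∑ᶠ e ∈ G.edgeSet, Sym2.lift ⟨fun a b => dist a b, fun a b => dist_comm a b⟩ e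

/-- The weight of a minimum spanning tree of the complete graph on the finite metric
space `V`, with edge weights given by the distances. -/
noncomputable def MSTweight (V : Type) [MetricSpace V] : ℝ :=
  sInf {x | ∃ T : SimpleGraph V, T.IsTree ∧ x = graphWeight T}

/-- The minimum weight of a Steiner tree for the terminal set `V'`: the minimum, over
vertex sets `U` with `V' ⊆ U ⊆ V` and trees `T` on `U`, of the total weight of `T`. -/
noncomputable def SteinerWeight (V : Type) [MetricSpace V] (V' : Set V) : ℝ :=
  sInf {x | ∃ U : Set V, V' ⊆ U ∧ ∃ T : SimpleGraph U, T.IsTree ∧ x = graphWeight T}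

open Classical in
/-- The weight of a graph as a sum over a finset of edges. -/
theorem graphWeight_eq_sum {V : Type} [Fintype V] [MetricSpace V] (G : SimpleGraph V) :
    graphWeight G = ∑ e ∈ G.edgeSet.toFinset,
      Sym2.lift ⟨fun a b => dist a b, fun a b => dist_comm a b⟩ e :=
  finsum_mem_eq_toFinset_sum _ _

theorem Sym2.lift_dist_nonneg {V : Type} [MetricSpace V] (e : Sym2 V) :
    0 ≤ Sym2.lift ⟨fun a b : V => dist a b, fun a b => dist_comm a b⟩ e := by
  induction e with | _ a b => exact dist_nonneg

/-- The tree weights of a finite metric space form a finite set. -/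
theorem finite_setOf_treeWeight (V : Type) [Fintype V] [MetricSpace V] :
    {x | ∃ T : SimpleGraph V, T.IsTree ∧ x = graphWeight T}.Finite :=
  (Set.finite_range (fun T : SimpleGraph V => graphWeight T)).subset
    fun _ ⟨T, _, h⟩ => ⟨T, h.symm⟩

theorem exists_isTree (V : Type) [Finite V] [Nonempty V] : ∃ T : SimpleGraph V, T.IsTree := by
  obtain ⟨T, -, hT⟩ := (SimpleGraph.connected_top (V := V)).exists_isTree_le
  exact ⟨T, hT⟩

theorem exists_isTree_graphWeight_eq_MSTweight (V : Type) [Fintype V] [Nonempty V]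
    [MetricSpace V] : ∃ T : SimpleGraph V, T.IsTree ∧ graphWeight T = MSTweight V := by
  obtain ⟨T₀, hT₀⟩ := exists_isTree V
  have hne : {x | ∃ T : SimpleGraph V, T.IsTree ∧ x = graphWeight T}.Nonempty :=
    ⟨_, T₀, hT₀, rfl⟩
  obtain ⟨T, hT, h⟩ := hne.csInf_mem (finite_setOf_treeWeight V)
  exact ⟨T, hT, h.symm⟩

theorem MSTweight_le_graphWeight {V : Type} [Fintype V] [MetricSpace V] {T : SimpleGraph V}
    (hT : T.IsTree) : MSTweight V ≤ graphWeight T :=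
  csInf_le (finite_setOf_treeWeight V).bddBelow ⟨T, hT, rfl⟩

/-- A connected graph has, at each vertex other than `r`, a neighbor one step closer to `r`. -/
theorem SimpleGraph.Connected.exists_adj_dist_add_one {V : Type} {G : SimpleGraph V}
    (hG : G.Connected) {r v : V} (hv : v ≠ r) :
    ∃ u, G.Adj v u ∧ G.dist u r + 1 = G.dist v r := by
  obtain ⟨p, hp⟩ := hG.exists_walk_length_eq_dist v r
  cases p with
  | nil => exact absurd rfl hv
  | @cons _ u _ h q =>
    refine ⟨u, h, ?_⟩
    have h1 : G.dist u r ≤ q.length := SimpleGraph.dist_le q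
    have h2 : G.dist v r ≤ G.dist v u + G.dist u r := hG.dist_triangle
    rw [SimpleGraph.dist_eq_one_iff_adj.mpr h] at h2
    rw [SimpleGraph.Walk.length_cons] at hp
    omega

section ParentMap

variable {V : Type} {T : SimpleGraph V} {r : V} {P : V → V}

theorem injOn_parentEdge (hP : ∀ v, v ≠ r → T.Adj v (P v) ∧ T.dist (P v) r + 1 = T.dist v r) :
    Set.InjOn (fun v => s(v, P v)) {v | v ≠ r} := by
  intro v hv w hw h
  rcases Sym2.eq_iff.mp h with ⟨h, -⟩ | ⟨h1, h2⟩
  · exact h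
  · have hv' := (hP v hv).2
    have hw' := (hP w hw).2
    rw [h2] at hv'
    rw [← h1] at hw'
    omega

open Classical in
theorem sum_dist_parent_le_graphWeight [Fintype V] [MetricSpace V]
    (hP : ∀ v, v ≠ r → T.Adj v (P v) ∧ T.dist (P v) r + 1 = T.dist v r) :
    ∑ v with v ≠ r, dist v (P v) ≤ graphWeight T := by
  have hinj : Set.InjOn (fun v => s(v, P v)) (Finset.univ.filter (· ≠ r) : Finset V) := by
    simpa using injOn_parentEdge hP
  rw [graphWeight_eq_sum]
  calc ∑ v with v ≠ r, dist v (P v)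
      = ∑ e ∈ (Finset.univ.filter (· ≠ r)).image (fun v => s(v, P v)),
          Sym2.lift ⟨fun a b => dist a b, fun a b => dist_comm a b⟩ e := by
        rw [Finset.sum_image hinj]; rfl
    _ ≤ _ := by
        refine Finset.sum_le_sum_of_subset_of_nonneg ?_ fun e _ _ => Sym2.lift_dist_nonneg e
        intro e he
        obtain ⟨v, hv, rfl⟩ := Finset.mem_image.mp he
        simpa using (hP v (by simpa using hv)).1

/-- Replacing the parent edges of the vertices of `U` by a connected graph on `U` keeps the
graph connected. -/
theorem connected_map_sup_parentEdges
    (hP : ∀ v, v ≠ r → T.Adj v (P v) ∧ T.dist (P v) r + 1 = T.dist v r)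
    {U : Set V} (hr : r ∈ U) {S : SimpleGraph U} (hS : S.Connected) :
    (S.map (Function.Embedding.subtype (· ∈ U)) ⊔
      SimpleGraph.fromEdgeSet ((fun v => s(v, P v)) '' Uᶜ)).Connected := by
  set H := S.map (Function.Embedding.subtype (· ∈ U)) ⊔
    SimpleGraph.fromEdgeSet ((fun v => s(v, P v)) '' Uᶜ)
  have hreach : ∀ n, ∀ v, T.dist v r = n → H.Reachable v r := by
    intro n
    induction n using Nat.strong_induction_on with
    | _ n ih =>
      intro v hv
      by_cases hvU : v ∈ U
      · have h := (hS.preconnected ⟨v, hvU⟩ ⟨r, hr⟩).map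
          (SimpleGraph.Embedding.map (Function.Embedding.subtype (· ∈ U)) S).toHom
        exact h.mono le_sup_left
      · have hvr : v ≠ r := fun h => hvU (h ▸ hr)
        obtain ⟨hadj, hd⟩ := hP v hvr
        have hH : H.Adj v (P v) :=
          Or.inr ((SimpleGraph.fromEdgeSet_adj _).mpr ⟨⟨v, hvU, rfl⟩, hadj.ne⟩)
        exact hH.reachable.trans (ih _ (by omega) _ rfl)
  have : Nonempty V := ⟨r⟩
  exact ⟨fun v w => (hreach _ v rfl).trans (hreach _ w rfl).symm⟩

open Classical in
theorem MSTweight_le_graphWeight_add_sum [Fintype V] [MetricSpace V]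
    (hP : ∀ v, v ≠ r → T.Adj v (P v) ∧ T.dist (P v) r + 1 = T.dist v r)
    {U : Set V} (hr : r ∈ U) {S : SimpleGraph U} (hS : S.Connected) :
    MSTweight V ≤ graphWeight S + ∑ v with v ∉ U, dist v (P v) := by
  obtain ⟨T', hle, hT'⟩ := (connected_map_sup_parentEdges hP hr hS).exists_isTree_le
  refine (MSTweight_le_graphWeight hT').trans ?_
  have hinj : Set.InjOn (fun v => s(v, P v)) (Finset.univ.filter (· ∉ U) : Finset V) := by
    refine (injOn_parentEdge hP).mono fun v hv => ?_
    rintro rfl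
    simp [hr] at hv
  set A := S.edgeSet.toFinset.image (Sym2.map ((↑) : U → V))
  set B := (Finset.univ.filter (· ∉ U)).image (fun v => s(v, P v))
  set w : Sym2 V → ℝ := Sym2.lift ⟨fun a b => dist a b, fun a b => dist_comm a b⟩ with hw
  have hA : ∑ e ∈ A, w e = graphWeight S := by
    rw [graphWeight_eq_sum, Finset.sum_image
      ((Sym2.map.injective Subtype.val_injective).injOn)]
    refine Finset.sum_congr rfl fun e _ => ?_
    induction e with | _ a b => rfl
  have hB : ∑ e ∈ B, w e = ∑ v with v ∉ U, dist v (P v) := by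
    rw [Finset.sum_image hinj]; rfl
  have hsub : T'.edgeSet.toFinset ⊆ A ∪ B := by
    intro e he
    induction e with | _ a b =>
    have hab := hle (by simpa using he : T'.Adj a b)
    rw [Finset.mem_union]
    rcases hab with hab | hab
    · left
      obtain ⟨x, y, hxy, rfl, rfl⟩ := (SimpleGraph.map_adj _ _ _ _).mp hab
      exact Finset.mem_image.mpr ⟨s(x, y), by simpa using hxy, rfl⟩
    · right
      obtain ⟨⟨v, hv, h⟩, -⟩ := (SimpleGraph.fromEdgeSet_adj _).mp hab
      exact Finset.mem_image.mpr ⟨v, by simpa using hv, h⟩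
  calc graphWeight T' = ∑ e ∈ T'.edgeSet.toFinset, w e := graphWeight_eq_sum T'
    _ ≤ ∑ e ∈ A ∪ B, w e :=
        Finset.sum_le_sum_of_subset_of_nonneg hsub fun e _ _ => Sym2.lift_dist_nonneg e
    _ ≤ ∑ e ∈ A ∪ B, w e + ∑ e ∈ A ∩ B, w e :=
        le_add_of_nonneg_right (Finset.sum_nonneg fun e _ => Sym2.lift_dist_nonneg e)
    _ = graphWeight S + ∑ v with v ∉ U, dist v (P v) := by
        rw [Finset.sum_union_inter, hA, hB]

end ParentMap

/-- There is a minimum spanning tree `T` of the complete graph on the finite metric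
space `V` such that, rooting `T` at `v₀` (with `P v` the parent of `v ≠ v₀`, i.e. the
neighbor of `v` one step closer to `v₀` in `T`), for every terminal set `V'` containing
`v₀` the sum of the parent-edge weights over `V' \ {v₀}` is at most the Steiner tree
weight of `V'`. -/
theorem mst_parent_edges_bounded_by_steiner
    (V : Type) [Fintype V] [MetricSpace V] (v₀ : V) (hV : 2 ≤ Fintype.card V) :
    ∃ T : SimpleGraph V, T.IsTree ∧ graphWeight T = MSTweight V ∧
      ∃ P : V → V,
        (∀ v, v ≠ v₀ → T.Adj v (P v) ∧ T.dist (P v) v₀ + 1 = T.dist v v₀) ∧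
        ∀ V' : Set V, v₀ ∈ V' →
          (∑ᶠ v ∈ V' \ {v₀}, dist v (P v)) ≤ SteinerWeight V V' := by
  classical
  have : Nonempty V := ⟨v₀⟩
  obtain ⟨T, hT, hmin⟩ := exists_isTree_graphWeight_eq_MSTweight V
  have hex : ∀ v, ∃ u, v ≠ v₀ → T.Adj v u ∧ T.dist u v₀ + 1 = T.dist v v₀ := fun v => by
    by_cases hv : v = v₀
    · exact ⟨v, fun h => absurd hv h⟩
    · obtain ⟨u, hu⟩ := hT.connected.exists_adj_dist_add_one hv
      exact ⟨u, fun _ => hu⟩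
  choose P hP using hex
  refine ⟨T, hT, hmin, P, hP, fun V' hv₀ => ?_⟩
  refine le_csInf ?_ ?_
  · have : Nonempty (Set.univ : Set V) := ⟨⟨v₀, trivial⟩⟩
    obtain ⟨S, hS⟩ := exists_isTree (Set.univ : Set V)
    exact ⟨_, Set.univ, Set.subset_univ _, S, hS, rfl⟩
  rintro _ ⟨U, hU, S, hS, rfl⟩
  have hlow := sum_dist_parent_le_graphWeight hP
  have hupp := MSTweight_le_graphWeight_add_sum hP (hU hv₀) hS.connected
  have hsplit : ∑ v with v ≠ v₀, dist v (P v) =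
      ∑ v with v ∈ U ∧ v ≠ v₀, dist v (P v) + ∑ v with v ∉ U, dist v (P v) := by
    rw [← Finset.sum_filter_add_sum_filter_not (Finset.univ.filter (· ≠ v₀)) (· ∈ U),
      Finset.filter_filter, Finset.filter_filter]
    congr 2
    · ext v
      simp [and_comm]
    · ext v
      simp only [Finset.mem_filter, Finset.mem_univ, true_and, and_iff_right_iff_imp]
      rintro hv rfl
      exact hv (hU hv₀)
  have hmono : ∑ᶠ v ∈ V' \ {v₀}, dist v (P v) ≤ ∑ v with v ∈ U ∧ v ≠ v₀, dist v (P v) := by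
    rw [finsum_mem_eq_toFinset_sum]
    refine Finset.sum_le_sum_of_subset_of_nonneg ?_ fun _ _ _ => dist_nonneg
    intro v hv
    simp only [Set.mem_toFinset, Set.mem_sdiff, Set.mem_singleton_iff] at hv
    simpa using ⟨hU hv.1, hv.2⟩
  linarith
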